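/- Proposition (the Fejér-type tapered kernel is an approximate identity; Proposition 7.3, parts (a)–(c)). Let h be a taper satisfying Assumption (H) and let k ≥ 2 be an integer. Then the Fejér-type tapered kernel Φ^h_{k,T} on ℝ^{k−1} satisfies: (a) sup_{T>0} ∫_{ℝ^{k−1}} |Φ^h_{k,T}(u)| du < ∞; (b) ∫_{ℝ^{k−1}} Φ^h_{k,T}(u) du = 1 for every T > 0; (c) for every δ > 0, ∫_{E_δ^c} |Φ^h_{k,T}(u)| du → 0 as T → ∞, where E_δ = {u = (u₁,…,u_{k−1}) ∈ ℝ^{k−1} : |u_i| ≤ δ for i = 1,…,k−1} and E_δ^c = ℝ^{k−1} \ E_δ. -/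

import Mathlib

open MeasureTheory Matrix Filter Topology
open scoped BigOperators ENNReal NNReal

noncomputable section

/-- The Fourier coefficient `ψ̂(t) = ∫_Λ e^{iλt} ψ(λ) dλ`, `Λ = [−π, π]`, `t ∈ ℤ`. -/
def fourierCoefL (ψ : ℝ → ℝ) (t : ℤ) : ℂ :=
  ∫ l in Set.Icc (-Real.pi) Real.pi, Complex.exp (Complex.I * t * l) * (ψ l : ℂ)

/-- The `T×T` Toeplitz matrix `B_T(ψ)` with entries `ψ̂(t−s)` (real, since `ψ` is even). -/
def toeplitzMat (ψ : ℝ → ℝ) (T : ℕ) : Matrix (Fin T) (Fin T) ℝ :=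
  fun t s => (fourierCoefL ψ ((t : ℤ) - (s : ℤ))).re

/-- `μ` is the centered Gaussian measure on `ℝ^T` with covariance matrix `R`:
`μ` is a probability measure each of whose one-dimensional linear projections is a
centered Gaussian with the corresponding variance. -/
def IsCenteredGaussianCov {T : ℕ} (μ : Measure (Fin T → ℝ))
    (R : Matrix (Fin T) (Fin T) ℝ) : Prop :=
  IsProbabilityMeasure μ ∧
    ∀ v : Fin T → ℝ,
      μ.map (fun x => ∑ i, v i * x i) =
        ProbabilityTheory.gaussianReal 0 (Real.toNNReal (v ⬝ᵥ R.mulVec v))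

/-- The distribution of the standard normalized Toeplitz quadratic form
`T^{−1/2} (xᵀ B_T(g) x − tr(B_T(f) B_T(g)))` under `μ_T`. -/
def QtildeDist (f g : ℝ → ℝ) (μ : (T : ℕ) → Measure (Fin T → ℝ)) (T : ℕ) : Measure ℝ :=
  (μ T).map (fun x =>
    (Real.sqrt T)⁻¹ *
      (x ⬝ᵥ (toeplitzMat g T).mulVec x - Matrix.trace (toeplitzMat f T * toeplitzMat g T)))

/-- `σ₀² = 16π³ ∫_Λ f²(λ)g²(λ) dλ`. -/
def sigma0Sq (f g : ℝ → ℝ) : ℝ :=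
  16 * Real.pi ^ 3 * ∫ l in Set.Icc (-Real.pi) Real.pi, (f l) ^ 2 * (g l) ^ 2

/-- The measures `Q T` converge weakly, as `T → ∞`, to the centered Gaussian
measure on `ℝ` with variance `v`. -/
def TendstoGaussianWeak (Q : ℕ → Measure ℝ) (v : ℝ) : Prop :=
  ∀ φ : BoundedContinuousFunction ℝ ℝ,
    Tendsto (fun T => ∫ x, φ x ∂(Q T)) atTop
      (𝓝 (∫ x, φ x ∂(ProbabilityTheory.gaussianReal 0 v.toNNReal)))

/-- Assumption (H): a taper is a continuous nonnegative function `h : ℝ → ℝ` of bounded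
variation with support contained in `[0,1]` such that `H_k = ∫₀¹ h^k ≠ 0` for all `k ≥ 1`. -/
def IsTaper (h : ℝ → ℝ) : Prop :=
  Continuous h ∧ (∀ t, 0 ≤ h t) ∧ (Function.support h ⊆ Set.Icc 0 1) ∧
    BoundedVariationOn h Set.univ ∧
    ∀ k : ℕ, 1 ≤ k → (∫ t in (0 : ℝ)..1, (h t) ^ k) ≠ 0

/-- `H_k = ∫₀¹ h^k(t) dt`. -/
def taperH (h : ℝ → ℝ) (k : ℕ) : ℝ := ∫ t in (0 : ℝ)..1, (h t) ^ k

/-- The `T×T` tapered Toeplitz matrix `B_T^h(ψ)` with entries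
`ψ̂(t−s)·h(t/T)·h(s/T)`, `1 ≤ t, s ≤ T`. -/
def toeplitzTaperedMat (h ψ : ℝ → ℝ) (T : ℕ) : Matrix (Fin T) (Fin T) ℝ :=
  fun t s => (fourierCoefL ψ ((t : ℤ) - (s : ℤ))).re *
    h (((t : ℕ) + 1 : ℝ) / T) * h (((s : ℕ) + 1 : ℝ) / T)

/-- `H_{k,T}(λ) = ∫₀^T h^k(t/T) e^{−iλt} dt`. -/
def fejerHkT (h : ℝ → ℝ) (k : ℕ) (T : ℝ) (l : ℝ) : ℂ :=
  ∫ t in (0 : ℝ)..T, (((h (t / T)) ^ k : ℝ) : ℂ) * Complex.exp (-Complex.I * l * t)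

/-- The Fejér-type tapered kernel `Φ^h_{k,T}` on `ℝ^{k−1}`, with `k = n + 1`:
`Φ^h_{k,T}(u) = H_{1,T}(u₁)⋯H_{1,T}(u_{k−1})·H_{1,T}(−(u₁+⋯+u_{k−1})) /
((2π)^{k−1} H_{k,T}(0))`. -/
def fejerKernel (h : ℝ → ℝ) (n : ℕ) (T : ℝ) (u : Fin n → ℝ) : ℂ :=
  ((∏ i, fejerHkT h 1 T (u i)) * fejerHkT h 1 T (-(∑ i, u i))) /
    ((((2 * Real.pi) ^ n : ℝ) : ℂ) * fejerHkT h (n + 1) T 0)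

open scoped FourierTransform

lemma taper_integrable {h : ℝ → ℝ} (hh : IsTaper h) : Integrable (fun t => (h t : ℂ)) := by
  obtain ⟨hc, h0, hs, hbv, -⟩ := hh
  refine Continuous.integrable_of_hasCompactSupport (by fun_prop) ?_
  refine HasCompactSupport.intro (isCompact_Icc (a := (0:ℝ)) (b := 1)) ?_
  intro x hx
  have : h x = 0 := by
    by_contra h'
    exact hx (hs h')
  simp [this]

/-- integral modulus of continuity of a BV function -/
lemma taper_shift {h : ℝ → ℝ} (hh : IsTaper h) :
    ∃ C : ℝ, 0 ≤ C ∧ ∀ a : ℝ, |a| ≤ 1 → ∫ t, |h t - h (t + a)| ≤ C * |a| := by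
  obtain ⟨hc, h0, hs, hbv, -⟩ := hh
  have hz : ∀ x, x ∉ Set.Icc (0:ℝ) 1 → h x = 0 := fun x hx => by
    by_contra h'
    exact hx (hs h')
  obtain ⟨p, q, hp, hq, hpq⟩ := hbv.locallyBoundedVariationOn.exists_monotoneOn_sub_monotoneOn
  rw [monotoneOn_univ] at hp hq
  set P : ℝ → ℝ := p + q with hP
  have hPm : Monotone P := hp.add hq
  have key : ∀ a : ℝ, 0 ≤ a → a ≤ 1 → ∫ t, |h t - h (t + a)| ≤ (P 2 - P (-1)) * a := by
    intro a ha ha1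
    have e1 : ∫ t, |h t - h (t + a)| = ∫ t in (-1:ℝ)..1, |h t - h (t + a)| := by
      rw [intervalIntegral.integral_of_le (by norm_num), ← integral_Icc_eq_integral_Ioc]
      rw [setIntegral_eq_integral_of_forall_compl_eq_zero]
      intro x hx
      have h1 : h x = 0 := hz x (fun h' => hx ⟨by linarith [h'.1], h'.2⟩)
      have h2 : h (x + a) = 0 := hz _ (fun h' => hx ⟨by linarith [h'.1], by linarith [h'.2]⟩)
      simp [h1, h2]
    have hi : ∀ b c : ℝ, IntervalIntegrable P volume b c := fun b c => hPm.intervalIntegrable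
    have hi2 : ∀ b c : ℝ, IntervalIntegrable (fun t => P (t + a)) volume b c := fun b c =>
      Monotone.intervalIntegrable (fun x y hxy => hPm (by linarith))
    have e2 : ∫ t in (-1:ℝ)..1, |h t - h (t + a)| ≤ ∫ t in (-1:ℝ)..1, (P (t + a) - P t) := by
      apply intervalIntegral.integral_mono_on (by norm_num)
      · exact Continuous.intervalIntegrable (by fun_prop) _ _
      · exact (hi2 _ _).sub (hi _ _)
      · intro x _
        have a1 := hp (show x ≤ x + a by linarith)
        have a2 := hq (show x ≤ x + a by linarith)
        simp only [hpq, hP, Pi.sub_apply, Pi.add_apply]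
        rw [abs_le]; constructor <;> linarith
    have e3 : ∫ t in (-1:ℝ)..1, (P (t + a) - P t)
        = (∫ t in (1:ℝ)..(1 + a), P t) - ∫ t in (-1:ℝ)..(-1 + a), P t := by
      rw [intervalIntegral.integral_sub (hi2 _ _) (hi _ _),
        intervalIntegral.integral_comp_add_right (fun t => P t)]
      have b1 := intervalIntegral.integral_add_adjacent_intervals (hi (-1) (-1 + a)) (hi (-1+a) (1+a))
      have b2 := intervalIntegral.integral_add_adjacent_intervals (hi (-1) 1) (hi 1 (1+a))
      linarith
    have e4 : (∫ t in (1:ℝ)..(1 + a), P t) ≤ ∫ t in (1:ℝ)..(1 + a), P 2 := by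
      apply intervalIntegral.integral_mono_on (by linarith) (hi _ _) (by simp)
      intro x hx; exact hPm (by linarith [hx.2])
    have e5 : (∫ t in (-1:ℝ)..(-1 + a), P (-1)) ≤ ∫ t in (-1:ℝ)..(-1 + a), P t := by
      apply intervalIntegral.integral_mono_on (by linarith) (by simp) (hi _ _)
      intro x hx; exact hPm (by linarith [hx.1])
    simp at e4 e5
    rw [e1]; linarith
  refine ⟨P 2 - P (-1), sub_nonneg.2 (hPm (by norm_num)), fun a ha => ?_⟩
  rcases le_total 0 a with h1 | h1
  · rw [abs_of_nonneg h1] at ha ⊢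
    exact key a h1 ha
  · rw [abs_of_nonpos h1] at ha ⊢
    have := key (-a) (by linarith) ha
    rw [← integral_add_right_eq_self _ a] at this
    refine le_trans (le_of_eq ?_) this
    refine integral_congr_ae (ae_of_all _ fun t => ?_)
    simp only
    rw [abs_sub_comm]; simp

lemma taper_fourier_bound {h : ℝ → ℝ} (hh : IsTaper h) :
    ∃ C : ℝ, 0 ≤ C ∧ ∀ w : ℝ, ‖𝓕 (fun t => (h t : ℂ)) w‖ ≤ C * (1 + ‖w‖)⁻¹ := by
  obtain ⟨C, hC0, hC⟩ := taper_shift hh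
  have hint := taper_integrable hh
  set M := ∫ t, ‖(h t : ℂ)‖ with hM
  have hM0 : 0 ≤ M := integral_nonneg (fun _ => norm_nonneg _)
  have b1 : ∀ w, ‖𝓕 (fun t => (h t : ℂ)) w‖ ≤ M := fun w => by
    rw [Real.fourier_eq]
    refine (norm_integral_le_integral_norm _).trans (le_of_eq ?_)
    simp [hM]
  refine ⟨2 * M + C, by positivity, fun w => ?_⟩
  rw [← div_eq_mul_inv, le_div_iff₀ (by positivity)]
  rcases le_total ‖w‖ 1 with hw | hw
  · have := b1 w
    nlinarith [norm_nonneg (𝓕 (fun t => (h t : ℂ)) w), norm_nonneg w]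
  · have hw0 : w ≠ 0 := by rintro rfl; simp at hw; linarith
    have hwp : 0 < ‖w‖ := by linarith
    have b2 : ‖𝓕 (fun t => (h t : ℂ)) w‖ ≤ C * (1 / (2 * ‖w‖)) := by
      rw [Real.fourier_eq, fourierIntegral_eq_half_sub_half_period_translate hw0 hint, norm_smul]
      have := hC ((1 / (2 * ‖w‖ ^ 2) : ℝ) • w) (by
        rw [← Real.norm_eq_abs, norm_smul]
        rw [Real.norm_of_nonneg (by positivity), div_mul_eq_mul_div, div_le_one (by positivity)]
        nlinarith)
      have e : |(1 / (2 * ‖w‖ ^ 2) : ℝ) • w| = 1 / (2 * ‖w‖) := by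
        rw [← Real.norm_eq_abs, norm_smul, Real.norm_of_nonneg (by positivity)]
        field_simp
      rw [e] at this
      have n1 := norm_integral_le_integral_norm (μ := volume) (fun v : ℝ => Real.fourierChar (-(inner ℝ v w)) •
        ((h v : ℂ) - (h (v + (1 / (2 * ‖w‖ ^ 2) : ℝ) • w) : ℂ)))
      have n2 : ∀ v : ℝ, ‖Real.fourierChar (-(inner ℝ v w)) •
        ((h v : ℂ) - (h (v + (1 / (2 * ‖w‖ ^ 2) : ℝ) • w) : ℂ))‖ = |h v - h (v + (1 / (2 * ‖w‖ ^ 2) : ℝ) • w)| := by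
        intro v
        rw [Circle.norm_smul, ← Complex.ofReal_sub, Complex.norm_real, Real.norm_eq_abs]
      simp_rw [n2] at n1
      have : ‖(1 / (2:ℂ))‖ = 1/2 := by simp
      rw [this]
      have := norm_nonneg (∫ v : ℝ, Real.fourierChar (-(inner ℝ v w)) •
        ((h v : ℂ) - (h (v + (1 / (2 * ‖w‖ ^ 2) : ℝ) • w) : ℂ)))
      linarith
    have b3 : C * (1 / (2 * ‖w‖)) * (1 + ‖w‖) ≤ C := by
      rw [mul_assoc]
      refine mul_le_of_le_one_right hC0 ?_
      rw [div_mul_eq_mul_div, div_le_one (by positivity)]; linarith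
    have := mul_le_mul_of_nonneg_right b2 (show 0 ≤ 1 + ‖w‖ by positivity)
    linarith

def fejPsi (h : ℝ → ℝ) (n : ℕ) (v : Fin n → ℝ) : ℂ :=
  (∏ i, 𝓕 (fun t => (h t : ℂ)) (v i)) * 𝓕 (fun t => (h t : ℂ)) (-(∑ i, v i))

lemma prod_min_le {n : ℕ} (hn : 1 ≤ n) (b : Fin n → ℝ) (c : ℝ) (hc : 0 ≤ c) (hb : ∀ i, c ≤ b i) :
    (∏ i, b i) * c ≤ ∏ i, (b i) ^ (1 + (n:ℝ)⁻¹) := by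
  have hb0 : ∀ i, 0 ≤ b i := fun i => hc.trans (hb i)
  have hn' : (0:ℝ) < n := by exact_mod_cast hn
  have e : ∀ i, (b i) ^ (1 + (n:ℝ)⁻¹) = b i * b i ^ ((n:ℝ)⁻¹) := fun i => by
    rw [Real.rpow_add' (hb0 i) (by positivity), Real.rpow_one]
  simp_rw [e, Finset.prod_mul_distrib]
  refine mul_le_mul_of_nonneg_left ?_ (Finset.prod_nonneg fun i _ => hb0 i)
  calc c = ∏ _i : Fin n, c ^ ((n:ℝ)⁻¹) := by
        rw [Finset.prod_const, Finset.card_univ, Fintype.card_fin, ← Real.rpow_natCast, ← Real.rpow_mul hc,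
          inv_mul_cancel₀ hn'.ne', Real.rpow_one]
    _ ≤ _ := Finset.prod_le_prod (fun i _ => by positivity)
        (fun i _ => Real.rpow_le_rpow hc (hb i) (by positivity))

/-- the reflection replacing the `j`-th coordinate by minus the sum -/
def reflMap (n : ℕ) (j : Fin n) : (Fin n → ℝ) →ₗ[ℝ] (Fin n → ℝ) where
  toFun v := Function.update v j (-(∑ i, v i))
  map_add' u v := by
    ext i
    by_cases hi : i = j
    · subst hi; simp [Finset.sum_add_distrib]; ring
    · simp [hi]
  map_smul' c v := by
    ext i
    by_cases hi : i = j
    · subst hi; simp [Finset.mul_sum]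
    · simp [hi]

lemma reflMap_sum (n : ℕ) (j : Fin n) (v : Fin n → ℝ) : ∑ i, reflMap n j v i = - v j := by
  change ∑ i, Function.update v j (-(∑ i, v i)) i = _
  rw [Finset.sum_update_of_mem (Finset.mem_univ j)]
  have := Finset.sum_eq_add_sum_sdiff_singleton_of_mem (Finset.mem_univ j) v
  linarith

lemma reflMap_invol (n : ℕ) (j : Fin n) : reflMap n j ∘ₗ reflMap n j = LinearMap.id := by
  ext1 i
  ext1
  simp only [LinearMap.comp_apply, LinearMap.id_apply]
  funext k
  generalize hv : (LinearMap.single ℝ (fun _ => ℝ) i) 1 = v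
  change Function.update (reflMap n j v) j (-(∑ i, reflMap n j v i)) k = v k
  rw [reflMap_sum]
  by_cases hk : k = j
  · subst hk; simp
  · simp [hk, reflMap]

lemma reflMap_integrable (n : ℕ) (j : Fin n) {f : (Fin n → ℝ) → ℝ} (hf : Integrable f) :
    Integrable (fun v => f (reflMap n j v)) := by
  have hd : LinearMap.det (reflMap n j) ≠ 0 := by
    intro h0
    have := congrArg LinearMap.det (reflMap_invol n j)
    rw [LinearMap.det_comp, h0] at this
    simp at this
  have hm := Measure.map_linearMap_addHaar_eq_smul_addHaar (μ := (volume : Measure (Fin n → ℝ))) hd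
  have hmeas : Measurable (reflMap n j) :=
    (LinearMap.continuous_of_finiteDimensional _).measurable
  have h2 : Integrable f (Measure.map (reflMap n j) volume) := by
    rw [hm]
    exact hf.smul_measure (by simp)
  exact h2.comp_measurable hmeas

lemma fejPsi_continuous {h : ℝ → ℝ} (hh : IsTaper h) (n : ℕ) : Continuous (fejPsi h n) := by
  have : Continuous (𝓕 (fun t => (h t : ℂ))) :=
    VectorFourier.fourierIntegral_continuous Real.continuous_fourierChar (by fun_prop) (taper_integrable hh)
  unfold fejPsi
  fun_prop

lemma fejPsi_integrable {h : ℝ → ℝ} (hh : IsTaper h) {n : ℕ} (hn : 1 ≤ n) :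
    Integrable (fejPsi h n) := by
  obtain ⟨C, hC0, hC⟩ := taper_fourier_bound hh
  set B : ℝ → ℝ := fun x => (1 + ‖x‖)⁻¹ with hB
  have hB0 : ∀ x, 0 ≤ B x := fun x => by positivity
  have hBneg : ∀ x, B (-x) = B x := fun x => by simp [hB]
  set p : ℝ := 1 + (n:ℝ)⁻¹ with hp
  have hn' : (0:ℝ) < n := by exact_mod_cast hn
  have hBi : Integrable (fun x => B x ^ p) := by
    have := integrable_one_add_norm (E := ℝ) (μ := volume) (r := p) (by simp [hp]; omega)
    refine this.congr (ae_of_all _ fun x => ?_)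
    simp only [hB]
    rw [Real.inv_rpow (by positivity), Real.rpow_neg (by positivity)]
  set F : (Fin n → ℝ) → ℝ := fun v => ∏ i, B (v i) ^ p with hF
  have hFi : Integrable F := Integrable.fintype_prod (f := fun _ x => B x ^ p) (fun _ => hBi)
  have hF0 : ∀ v, 0 ≤ F v := fun v => Finset.prod_nonneg fun i _ => Real.rpow_nonneg (hB0 _) _
  have hG : Integrable (fun v => C ^ (n+1) * (F v + ∑ j, F (reflMap n j v))) :=
    (hFi.add (integrable_finsetSum _ fun j _ => reflMap_integrable n j hFi)).const_mul _
  refine hG.mono' (fejPsi_continuous hh n).aestronglyMeasurable (ae_of_all _ fun v => ?_)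
  have s1 : ‖fejPsi h n v‖ ≤ C ^ (n+1) * ((∏ i, B (v i)) * B (∑ i, v i)) := by
    rw [fejPsi, norm_mul, norm_prod]
    calc _ ≤ (∏ i, (C * B (v i))) * (C * B (-∑ i, v i)) := by
          apply mul_le_mul _ (hC _) (norm_nonneg _)
          · exact Finset.prod_nonneg fun i _ => mul_nonneg hC0 (hB0 _)
          · exact Finset.prod_le_prod (fun _ _ => norm_nonneg _) (fun i _ => hC _)
      _ = _ := by
          rw [Finset.prod_mul_distrib, hBneg]; simp; ring
  refine s1.trans (mul_le_mul_of_nonneg_left ?_ (by positivity))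
  have hs0 : 0 ≤ ∑ j, F (reflMap n j v) := Finset.sum_nonneg fun j _ => hF0 _
  by_cases hmin : ∀ i, B (∑ i, v i) ≤ B (v i)
  · have := prod_min_le hn (fun i => B (v i)) _ (hB0 _) hmin
    simp only [hF] at *
    linarith
  · push Not at hmin
    obtain ⟨i₀, hi₀⟩ := hmin
    obtain ⟨j, -, hj⟩ := Finset.exists_min_image Finset.univ (fun i => B (v i)) ⟨i₀, Finset.mem_univ _⟩
    have hle : B (v j) ≤ B (∑ i, v i) := (hj i₀ (Finset.mem_univ _)).trans hi₀.le
    have hw : (fun i => B (reflMap n j v i)) = Function.update (fun i => B (v i)) j (B (∑ i, v i)) := by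
      funext i
      by_cases hi : i = j
      · subst hi; simp [reflMap, hBneg]
      · simp [hi, reflMap]
    have h1 := prod_min_le hn (fun i => B (reflMap n j v i)) (B (v j)) (hB0 _) (fun i => by
      have := congrFun hw i
      rw [this]
      by_cases hi : i = j
      · subst hi; simpa using hle
      · simpa [hi] using hj i (Finset.mem_univ _))
    have h2 : (∏ i, B (reflMap n j v i)) * B (v j) = (∏ i, B (v i)) * B (∑ i, v i) := by
      rw [hw, Finset.prod_update_of_mem (Finset.mem_univ j),
        Finset.prod_eq_mul_prod_sdiff_singleton_of_mem (Finset.mem_univ j) (fun i => B (v i))]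
      ring
    rw [← h2]
    have h3 := Finset.single_le_sum (f := fun j => F (reflMap n j v)) (fun j _ => hF0 _) (Finset.mem_univ j)
    have := hF0 v
    refine h1.trans ?_
    change F (reflMap n j v) ≤ _
    linarith

lemma taper_zero {h : ℝ → ℝ} (hh : IsTaper h) (x : ℝ) (hx : x ∉ Set.Icc (0:ℝ) 1) : h x = 0 := by
  by_contra h'
  exact hx (hh.2.2.1 h')

/-- the two-variable correlation integrand -/
def corrF (h : ℝ → ℝ) (n : ℕ) (s : EuclideanSpace ℝ (Fin n)) (t : ℝ) : ℂ :=
  (h t : ℂ) * ∏ i, (h (t + s i) : ℂ)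

lemma corrF_continuous {h : ℝ → ℝ} (hh : IsTaper h) (n : ℕ) :
    Continuous (Function.uncurry (corrF h n)) := by
  have hc := hh.1
  unfold corrF Function.uncurry
  fun_prop

lemma corrF_integrable {h : ℝ → ℝ} (hh : IsTaper h) (n : ℕ) :
    Integrable (Function.uncurry (corrF h n))
      ((volume : Measure (EuclideanSpace ℝ (Fin n))).prod (volume : Measure ℝ)) := by
  refine Continuous.integrable_of_hasCompactSupport (corrF_continuous hh n) ?_
  have hK : IsCompact ((Set.image (WithLp.toLp 2) (Set.Icc (fun _ : Fin n => (-1:ℝ)) (fun _ => 1)) :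
      Set (EuclideanSpace ℝ (Fin n))) ×ˢ (Set.Icc (0:ℝ) 1)) :=
    (isCompact_Icc.image (PiLp.continuous_toLp 2 _)).prod isCompact_Icc
  refine HasCompactSupport.intro hK ?_
  rintro ⟨s, t⟩ hst
  simp only [Function.uncurry, corrF]
  by_contra hne
  have h1 : h t ≠ 0 := by
    intro h0; apply hne; simp [h0]
  have h2 : ∀ i, h (t + s i) ≠ 0 := by
    intro i h0; apply hne
    rw [Finset.prod_eq_zero (Finset.mem_univ i) (by simp [h0]), mul_zero]
  have t1 := hh.2.2.1 h1
  apply hst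
  refine ⟨⟨s.ofLp, ?_, rfl⟩, t1⟩
  constructor
  · intro i
    have := hh.2.2.1 (h2 i)
    simp only
    linarith [this.1, t1.2]
  · intro i
    have := hh.2.2.1 (h2 i)
    simp only
    linarith [this.2, t1.1]

def corrK (h : ℝ → ℝ) (n : ℕ) (s : EuclideanSpace ℝ (Fin n)) : ℂ := ∫ t, corrF h n s t

lemma corrK_continuous {h : ℝ → ℝ} (hh : IsTaper h) (n : ℕ) : Continuous (corrK h n) := by
  have : corrK h n = fun s => ∫ t in (0:ℝ)..1, corrF h n s t := by
    funext s
    rw [intervalIntegral.integral_of_le (by norm_num), ← integral_Icc_eq_integral_Ioc,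
      setIntegral_eq_integral_of_forall_compl_eq_zero]
    · rfl
    · intro x hx
      simp [corrF, taper_zero hh x hx]
  rw [this]
  exact intervalIntegral.continuous_parametric_intervalIntegral_of_continuous' (corrF_continuous hh n) _ _

lemma corrK_integrable {h : ℝ → ℝ} (hh : IsTaper h) (n : ℕ) : Integrable (corrK h n) :=
  (corrF_integrable hh n).integral_prod_left

lemma fourier_shift (h : ℝ → ℝ) (t w : ℝ) :
    ∫ s : ℝ, (Real.fourierChar (-(s * w)) : ℂ) * (h (t + s) : ℂ)
      = (Real.fourierChar (t * w) : ℂ) * 𝓕 (fun t => (h t : ℂ)) w := by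
  rw [Real.fourier_real_eq, ← integral_const_mul,
    ← integral_add_left_eq_self (fun s : ℝ => (Real.fourierChar (t * w) : ℂ) *
      (Real.fourierChar (-(s * w)) • (h s : ℂ))) t]
  refine integral_congr_ae (ae_of_all _ fun s => ?_)
  simp only [Circle.smul_def, smul_eq_mul, ← mul_assoc, ← Circle.coe_mul, ← AddChar.map_add_eq_mul]
  congr 3
  ring_nf

lemma fourierChar_sum {n : ℕ} (f : Fin n → ℝ) :
    (Real.fourierChar (∑ i, f i) : ℂ) = ∏ i, (Real.fourierChar (f i) : ℂ) := by
  rw [Real.fourierChar_apply]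
  simp_rw [Real.fourierChar_apply]
  rw [← Complex.exp_sum]
  push_cast
  rw [Finset.mul_sum, Finset.sum_mul]

lemma corrK_fourier {h : ℝ → ℝ} (hh : IsTaper h) (n : ℕ) (v : EuclideanSpace ℝ (Fin n)) :
    𝓕 (corrK h n) v = fejPsi h n v.ofLp := by
  rw [Real.fourier_eq]
  have e1 : ∀ s : EuclideanSpace ℝ (Fin n), Real.fourierChar (-(inner ℝ s v)) • corrK h n s
      = ∫ t, (Real.fourierChar (-(inner ℝ s v)) : ℂ) * corrF h n s t := by
    intro s
    rw [corrK, Circle.smul_def, smul_eq_mul, integral_const_mul]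
  simp_rw [e1]
  have hint : Integrable (Function.uncurry fun (s : EuclideanSpace ℝ (Fin n)) (t : ℝ) =>
      (Real.fourierChar (-(inner ℝ s v)) : ℂ) * corrF h n s t)
      ((volume : Measure (EuclideanSpace ℝ (Fin n))).prod (volume : Measure ℝ)) := by
    refine (corrF_integrable hh n).mono ?_ (ae_of_all _ ?_)
    · refine Continuous.aestronglyMeasurable ?_
      have := corrF_continuous hh n
      have h2 := Real.continuous_fourierChar
      refine Continuous.mul ?_ this
      fun_prop
    · rintro ⟨s, t⟩
      simp only [Function.uncurry, norm_mul, Circle.norm_coe, one_mul, le_refl]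
  rw [integral_integral_swap hint]
  have e2 : ∀ t : ℝ, ∫ s : EuclideanSpace ℝ (Fin n),
      (Real.fourierChar (-(inner ℝ s v)) : ℂ) * corrF h n s t
      = (∏ i, 𝓕 (fun t => (h t : ℂ)) (v i)) * ((Real.fourierChar (-(t * (-∑ i, v i))) : ℂ) * (h t : ℂ)) := by
    intro t
    rw [← (PiLp.volume_preserving_toLp (Fin n)).integral_comp
      (MeasurableEquiv.toLp 2 (Fin n → ℝ)).measurableEmbedding]
    have e3 : ∀ s : Fin n → ℝ, (Real.fourierChar (-(inner ℝ (WithLp.toLp 2 s : EuclideanSpace ℝ (Fin n)) v)) : ℂ)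
        * corrF h n (WithLp.toLp 2 s) t
        = (h t : ℂ) * ∏ i, ((Real.fourierChar (-(s i * v i)) : ℂ) * (h (t + s i) : ℂ)) := by
      intro s
      have : -(inner ℝ (WithLp.toLp 2 s : EuclideanSpace ℝ (Fin n)) v) = ∑ i, -(s i * v i) := by
        simp [PiLp.inner_apply, mul_comm]
      rw [this, fourierChar_sum, Finset.prod_mul_distrib, corrF]
      ring
    simp_rw [e3]
    rw [integral_const_mul, integral_fintype_prod_volume_eq_prod
      (f := fun i (x : ℝ) => (Real.fourierChar (-(x * v i)) : ℂ) * (h (t + x) : ℂ))]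
    simp_rw [fourier_shift, Finset.prod_mul_distrib]
    rw [← fourierChar_sum, ← Finset.mul_sum]
    ring_nf
  simp_rw [e2]
  rw [integral_const_mul, fejPsi, Real.fourier_real_eq (fun t => (h t : ℂ)) (-∑ i, v.ofLp i)]
  simp [Circle.smul_def]

lemma fejPsi_integral {h : ℝ → ℝ} (hh : IsTaper h) {n : ℕ} (hn : 1 ≤ n) :
    ∫ v, fejPsi h n v = ((∫ t in (0:ℝ)..1, (h t) ^ (n + 1) : ℝ) : ℂ) := by
  have hF : 𝓕 (corrK h n) = fun v => fejPsi h n v.ofLp := funext (corrK_fourier hh n)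
  have hemb := (MeasurableEquiv.toLp 2 (Fin n → ℝ)).symm.measurableEmbedding
  have hI : Integrable (𝓕 (corrK h n)) := by
    rw [hF]
    exact ((PiLp.volume_preserving_ofLp (Fin n)).integrable_comp_emb hemb).2 (fejPsi_integrable hh hn)
  have inv := congrFun ((corrK_continuous hh n).fourierInv_fourier_eq (corrK_integrable hh n) hI) 0
  rw [Real.fourierInv_eq, hF] at inv
  simp only [inner_zero_right, AddChar.map_zero_eq_one, one_smul] at inv
  have := (PiLp.volume_preserving_ofLp (Fin n)).integral_comp hemb (fejPsi h n)
  rw [← this, inv, corrK, ← intervalIntegral.integral_ofReal,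
    intervalIntegral.integral_of_le (by norm_num), ← integral_Icc_eq_integral_Ioc,
      setIntegral_eq_integral_of_forall_compl_eq_zero]
  · refine integral_congr_ae (ae_of_all _ fun t => ?_)
    simp [corrF, pow_succ, mul_comm]
  · intro x hx
    simp [taper_zero hh x hx]

lemma fejerHkT_one {h : ℝ → ℝ} (hh : IsTaper h) {T : ℝ} (hT : 0 < T) (l : ℝ) :
    fejerHkT h 1 T l = (T : ℂ) * 𝓕 (fun t => (h t : ℂ)) (T / (2 * Real.pi) * l) := by
  have e : ∀ t : ℝ, (((h (t / T)) ^ 1 : ℝ) : ℂ) * Complex.exp (-Complex.I * l * t)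
     = (fun x : ℝ => (h x : ℂ) * Complex.exp (-Complex.I * l * (T * x))) (t / T) := by
    intro t
    simp only [pow_one]
    congr 2
    push_cast
    have : (T : ℂ) ≠ 0 := by exact_mod_cast hT.ne'
    field_simp
  unfold fejerHkT
  simp_rw [e]
  rw [intervalIntegral.integral_comp_div
      (fun x : ℝ => (h x : ℂ) * Complex.exp (-Complex.I * l * (T * x))) hT.ne',
    zero_div, div_self hT.ne', Real.fourier_real_eq_integral_exp_smul, intervalIntegral.integral_of_le (by norm_num),
    ← integral_Icc_eq_integral_Ioc, setIntegral_eq_integral_of_forall_compl_eq_zero]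
  · rw [Complex.real_smul]
    congr 1
    refine integral_congr_ae (ae_of_all _ fun t => ?_)
    simp only [smul_eq_mul]
    rw [mul_comm]
    congr 2
    push_cast
    have : (Real.pi : ℂ) ≠ 0 := by exact_mod_cast Real.pi_ne_zero
    field_simp
  · intro x hx
    simp [taper_zero hh x hx]

lemma fejerHkT_zero (h : ℝ → ℝ) (k : ℕ) {T : ℝ} (hT : 0 < T) :
    fejerHkT h k T 0 = ((T * ∫ t in (0:ℝ)..1, (h t) ^ k : ℝ) : ℂ) := by
  unfold fejerHkT
  simp only [Complex.ofReal_zero, mul_zero, zero_mul, Complex.exp_zero, mul_one]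
  rw [intervalIntegral.integral_ofReal, intervalIntegral.integral_comp_div (fun x => h x ^ k) hT.ne',
    zero_div, div_self hT.ne', smul_eq_mul]

lemma fejerKernel_scale {h : ℝ → ℝ} (hh : IsTaper h) (n : ℕ) {T : ℝ} (hT : 0 < T) (u : Fin n → ℝ) :
    fejerKernel h n T u = (((T / (2 * Real.pi)) ^ n * (∫ t in (0:ℝ)..1, (h t) ^ (n+1))⁻¹ : ℝ) : ℂ) *
      fejPsi h n ((T / (2 * Real.pi)) • u) := by
  have hH := hh.2.2.2.2 (n+1) (by omega)
  unfold fejerKernel fejPsi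
  rw [fejerHkT_zero h _ hT]
  simp_rw [fejerHkT_one hh hT]
  rw [Finset.prod_mul_distrib]
  simp only [Finset.prod_const, Finset.card_univ, Fintype.card_fin, Pi.smul_apply, smul_eq_mul,
    ← Finset.mul_sum, mul_neg]
  set A := ∫ t in (0:ℝ)..1, (h t) ^ (n+1)
  have h1 : (A : ℂ) ≠ 0 := by exact_mod_cast hH
  have h2 : (T : ℂ) ≠ 0 := by exact_mod_cast hT.ne'
  have h3 : (Real.pi : ℂ) ≠ 0 := by exact_mod_cast Real.pi_ne_zero
  push_cast
  rw [div_pow]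
  field_simp

lemma lintegral_scale (n : ℕ) {r : ℝ} (hr : 0 < r) {f : (Fin n → ℝ) → ℝ≥0∞} (hf : Measurable f) :
    ENNReal.ofReal (r ^ n) * ∫⁻ u, f (r • u) = ∫⁻ v, f v := by
  have hm := Measure.map_addHaar_smul (volume : Measure (Fin n → ℝ)) hr.ne'
  have : ∫⁻ u, f (r • u) = ∫⁻ v, f v ∂(Measure.map (fun x => r • x) volume) :=
    (lintegral_map hf (measurable_const_smul r)).symm
  rw [this, hm, lintegral_smul_measure, smul_eq_mul, ← mul_assoc, ← ENNReal.ofReal_mul (by positivity)]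
  simp only [Module.finrank_fintype_fun_eq_card, Fintype.card_fin]
  rw [abs_of_pos (by positivity), mul_inv_cancel₀ (by positivity)]
  simp

/-- Proposition 7.3 (a)–(c): the Fejér-type tapered kernel `Φ^h_{k,T}` (`k = n+1 ≥ 2`)
is an approximate identity:
(a) the `L¹`-norms are bounded uniformly in `T > 0`;
(b) `∫ Φ^h_{k,T} = 1`;
(c) the mass outside any `δ`-cube around the origin tends to `0` as `T → ∞`. -/
theorem fejer_kernel_approximate_identity
    (h : ℝ → ℝ) (hh : IsTaper h) (n : ℕ) (hn : 1 ≤ n) :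
    (∃ C : ℝ≥0∞, C ≠ ⊤ ∧ ∀ T : ℝ, 0 < T →
        (∫⁻ u : Fin n → ℝ, ENNReal.ofReal ‖fejerKernel h n T u‖) ≤ C) ∧
    (∀ T : ℝ, 0 < T → (∫ u : Fin n → ℝ, fejerKernel h n T u) = 1) ∧
    (∀ δ : ℝ, 0 < δ →
      Tendsto (fun T : ℝ =>
          ∫⁻ u in {u : Fin n → ℝ | ∃ i, δ < |u i|}, ENNReal.ofReal ‖fejerKernel h n T u‖)
        atTop (𝓝 0)) := by
  set A := ∫ t in (0:ℝ)..1, (h t) ^ (n+1) with hA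
  have hH : A ≠ 0 := hh.2.2.2.2 (n+1) (by omega)
  have hA0 : 0 ≤ A := intervalIntegral.integral_nonneg (by norm_num) fun t _ => pow_nonneg (hh.2.1 t) _
  have hint := fejPsi_integrable hh hn
  have hmeas : Measurable (fun v => ENNReal.ofReal ‖fejPsi h n v‖) :=
    (fejPsi_continuous hh n).measurable.norm.ennreal_ofReal
  have hfin : ∫⁻ v, ENNReal.ofReal ‖fejPsi h n v‖ ≠ ⊤ := by
    have := hint.2
    rw [hasFiniteIntegral_iff_norm] at this
    exact this.ne
  have hnorm : ∀ T : ℝ, 0 < T → ∀ u : Fin n → ℝ, ENNReal.ofReal ‖fejerKernel h n T u‖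
      = ENNReal.ofReal A⁻¹ * (ENNReal.ofReal ((T / (2 * Real.pi)) ^ n)
        * ENNReal.ofReal ‖fejPsi h n ((T / (2 * Real.pi)) • u)‖) := by
    intro T hT u
    rw [fejerKernel_scale hh n hT u, norm_mul, Complex.norm_real, Real.norm_of_nonneg (by positivity),
      ← ENNReal.ofReal_mul (by positivity), ← ENNReal.ofReal_mul (by positivity)]
    congr 1; ring
  have hset : ∀ (S : Set (Fin n → ℝ)), MeasurableSet S → ∀ T : ℝ, 0 < T →
      ∫⁻ u in (fun u => (T / (2 * Real.pi)) • u) ⁻¹' S, ENNReal.ofReal ‖fejerKernel h n T u‖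
      = ENNReal.ofReal A⁻¹ * ∫⁻ v, S.indicator (fun v => ENNReal.ofReal ‖fejPsi h n v‖) v := by
    intro S hS T hT
    simp_rw [hnorm T hT]
    rw [lintegral_const_mul' _ _ ENNReal.ofReal_ne_top, lintegral_const_mul' _ _ ENNReal.ofReal_ne_top,
      ← lintegral_indicator (hS.preimage (measurable_const_smul _)),
      ← lintegral_scale n (r := T / (2 * Real.pi)) (by positivity) (hmeas.indicator hS)]
    rfl
  refine ⟨⟨ENNReal.ofReal A⁻¹ * ∫⁻ v, ENNReal.ofReal ‖fejPsi h n v‖,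
    ENNReal.mul_ne_top ENNReal.ofReal_ne_top hfin, fun T hT => ?_⟩, fun T hT => ?_, fun δ hδ => ?_⟩
  · have := hset Set.univ MeasurableSet.univ T hT
    simp only [Set.preimage_univ, Measure.restrict_univ, Set.indicator_univ] at this
    exact this.le
  · simp_rw [fejerKernel_scale hh n hT]
    rw [integral_const_mul, Measure.integral_comp_smul, fejPsi_integral hh hn, ← hA]
    simp only [Module.finrank_fintype_fun_eq_card, Fintype.card_fin]
    rw [abs_of_pos (by positivity), Complex.real_smul, ← Complex.ofReal_mul, ← Complex.ofReal_mul]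
    rw [← Complex.ofReal_one]
    congr 1
    field_simp
  · set S : ℝ → Set (Fin n → ℝ) := fun T => {v | ∃ i, T / (2 * Real.pi) * δ < |v i|} with hS
    have hSm : ∀ T, MeasurableSet (S T) := by
      intro T
      simp only [hS, Set.ofPred_exists]
      exact MeasurableSet.iUnion fun i =>
        measurableSet_lt measurable_const (measurable_pi_apply i).norm
    have hlim : Tendsto (fun T => ∫⁻ v, (S T).indicator (fun v => ENNReal.ofReal ‖fejPsi h n v‖) v)
        atTop (𝓝 (∫⁻ _v : Fin n → ℝ, 0)) := by
      refine tendsto_lintegral_filter_of_dominated_convergence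
        (fun v => ENNReal.ofReal ‖fejPsi h n v‖) (Eventually.of_forall fun T => hmeas.indicator (hSm T))
        (Eventually.of_forall fun T => ae_of_all _ fun v => Set.indicator_le_self _ _ _) hfin
        (ae_of_all _ fun v => ?_)
      refine tendsto_const_nhds.congr' ?_
      have ht : Tendsto (fun T : ℝ => T / (2 * Real.pi) * δ) atTop atTop :=
        (tendsto_id.atTop_div_const (by positivity)).atTop_mul_const hδ
      filter_upwards [ht.eventually_ge_atTop ‖v‖] with T hT
      rw [Set.indicator_of_notMem]
      rintro ⟨i, hi⟩
      have := norm_le_pi_norm v i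
      rw [Real.norm_eq_abs] at this
      linarith
    have hlim2 := ENNReal.Tendsto.const_mul (a := ENNReal.ofReal A⁻¹) hlim (Or.inr ENNReal.ofReal_ne_top)
    simp only [lintegral_zero, mul_zero] at hlim2
    refine hlim2.congr' ?_
    filter_upwards [eventually_gt_atTop 0] with T hT
    rw [← hset _ (hSm T) T hT]
    congr 2
    ext u
    simp only [hS, Set.mem_preimage, Set.mem_ofPred_eq, Pi.smul_apply, smul_eq_mul]
    refine exists_congr fun i => ?_
    have hp : 0 < T / (2 * Real.pi) := by positivity
    rw [abs_mul, abs_of_pos hp]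
    exact mul_lt_mul_iff_right₀ hp
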